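/- arXiv:1608.06372 — 4 statements merged into one kernel-verified Lean document; each statement's English description precedes it below -/
import Mathlib

section
/- Let n ≥ 0. If n ≥ μ_r, then I_n is the ideal of K[X_n] generated by all monomials x_{i_1}^{a_1} x_{i_2}^{a_2} ⋯ x_{i_r}^{a_r} with μ_1 ≤ i_1, i_r ≤ n, and i_{j+1} − i_j ≥ μ_{j+1} − μ_j for each j = 1, …, r−1; and if 0 ≤ n < μ_r, then I_n = 0. -/
open MvPolynomial

noncomputable section

/-- The monomial `x_{μ 0}^{a 0} ⋯ x_{μ (r-1)}^{a (r-1)}` in `K[X] = K[x_j : j ≥ 1]`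
(variables indexed by `ℕ`; only indices `≥ 1` occur). -/
def orbMon (K : Type*) [Field K] (r : ℕ) (μ a : ℕ → ℕ) : MvPolynomial ℕ K :=
  ∏ j ∈ Finset.range r, (X (μ j) : MvPolynomial ℕ K) ^ a j

/-- The ideal generated by the `Inc`-orbit of a polynomial, where the monoid `Inc` of
strictly increasing maps acts by renaming the indices of the variables. -/
def orbitIdeal (K : Type*) [Field K] (m : MvPolynomial ℕ K) : Ideal (MvPolynomial ℕ K) :=
  Ideal.span {q | ∃ π : ℕ → ℕ, StrictMono π ∧ q = rename π m}

/-- Index type for the variables `x_1, …, x_n` of `K[X_n]`. -/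
abbrev VarIdx (n : ℕ) := {j : ℕ // j ∈ Finset.Icc 1 n}

/-- The inclusion `K[X_n] → K[X]`. -/
def toBig (K : Type*) [Field K] (n : ℕ) : MvPolynomial (VarIdx n) K →ₐ[K] MvPolynomial ℕ K :=
  rename Subtype.val

/-- `I_n = I ∩ K[X_n]`, realized as an ideal of `K[X_n]` (this is legitimate because
`toBig` is injective). -/
def restr (K : Type*) [Field K] (I : Ideal (MvPolynomial ℕ K)) (n : ℕ) :
    Ideal (MvPolynomial (VarIdx n) K) :=
  Ideal.comap (toBig K n) I

/-- The inclusion `K[X_m] → K[X_n]` for `m ≤ n`. -/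
def incl (K : Type*) [Field K] {m n : ℕ} (h : m ≤ n) :
    MvPolynomial (VarIdx m) K →ₐ[K] MvPolynomial (VarIdx n) K :=
  rename fun j => ⟨j.1, Finset.Icc_subset_Icc le_rfl h j.2⟩

/-- The dimension of the degree `j` component of `K[X_n]/I`, for a homogeneous ideal `I`:
the `K`-dimension of (homogeneous polynomials of degree `j`) modulo (those lying in `I`). -/
def hilbF (K : Type*) [Field K] {σ : Type*} (I : Ideal (MvPolynomial σ K)) (j : ℕ) : ℕ :=
  Module.finrank K
    (↥(homogeneousSubmodule σ K j) ⧸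
      (Submodule.comap (homogeneousSubmodule σ K j).subtype (Submodule.restrictScalars K I)))

/-- The Hilbert series of `K[X_n]/I` as a power series in `ℤ[[t]]`. -/
def hseries (K : Type*) [Field K] {σ : Type*} (I : Ideal (MvPolynomial σ K)) :
    PowerSeries ℤ :=
  PowerSeries.mk fun j => (hilbF K I j : ℤ)

end

/-- A finite sequence `i` that starts at or above `μ 0` and whose gaps dominate those of `μ`
is the image of `μ` under a strictly increasing map. -/
lemma exists_strictMono_apply_eq {r : ℕ} {μ i : ℕ → ℕ}
    (hμ : ∀ j, j + 1 < r → μ j < μ (j + 1)) (h0 : μ 0 ≤ i 0)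
    (hi : ∀ j, j + 1 < r → i j + μ (j + 1) ≤ i (j + 1) + μ j) :
    ∃ π : ℕ → ℕ, StrictMono π ∧ ∀ j < r, π (μ j) = i j := by
  have hlt : ∀ j k, j < k → k < r → μ j < μ k := by
    intro j k hjk
    induction k, hjk using Nat.le_induction with
    | base => exact hμ j
    | succ k _ ih => exact fun hk => (ih (by omega)).trans (hμ k hk)
  have hgap : ∀ j k, j ≤ k → k < r → i j + μ k ≤ i k + μ j := by
    intro j k hjk
    induction k, hjk using Nat.le_induction with
    | base => intro; omega
    | succ k _ ih =>
      intro hk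
      have h₁ := ih (by omega)
      have h₂ := hi k hk
      omega
  refine ⟨fun m => m + ((Finset.range r).filter fun j => μ j ≤ m).sup fun j => i j - μ j,
    fun m m' h => ?_, fun j hj => ?_⟩
  · refine add_lt_add_of_lt_of_le h (Finset.sup_mono fun j hj => ?_)
    simp only [Finset.mem_filter] at hj ⊢
    exact ⟨hj.1, hj.2.trans h.le⟩
  · have hle : μ j ≤ i j := by
      have := hgap 0 j (Nat.zero_le j) hj
      omega
    have hsup : (((Finset.range r).filter fun k => μ k ≤ μ j).sup fun k => i k - μ k) =
        i j - μ j := by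
      apply le_antisymm
      · refine Finset.sup_le fun k hk => ?_
        simp only [Finset.mem_filter, Finset.mem_range] at hk
        have hkj : k ≤ j := by
          by_contra! hjk
          exact absurd (hlt j k hjk hk.1) (by omega)
        have := hgap k j hkj hj
        omega
      · exact Finset.le_sup (f := fun k => i k - μ k) (by simpa using hj)
    simp only [hsup]
    omega

/-- The retraction `K[X] → K[X_n]` killing all variables other than `x_1, …, x_n`. -/
noncomputable def truncate (K : Type*) [Field K] (n : ℕ) :
    MvPolynomial ℕ K →ₐ[K] MvPolynomial (VarIdx n) K :=
  aeval fun j => if h : j ∈ Finset.Icc 1 n then X ⟨j, h⟩ else 0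

lemma truncate_toBig (K : Type*) [Field K] (n : ℕ) (f : MvPolynomial (VarIdx n) K) :
    truncate K n (toBig K n f) = f := by
  have h : (truncate K n).comp (toBig K n) = AlgHom.id K _ := by
    ext j : 1
    simp only [truncate, toBig, AlgHom.comp_apply, rename_X, aeval_X, AlgHom.id_apply]
    exact dif_pos j.2
  exact DFunLike.congr_fun h f

lemma rename_orbMon (K : Type*) [Field K] (r : ℕ) (μ a π : ℕ → ℕ) :
    rename π (orbMon K r μ a) = orbMon K r (π ∘ μ) a := by
  simp [orbMon]

lemma toBig_prod_X_pow (K : Type*) [Field K] (r n : ℕ) (a : ℕ → ℕ) (i : ℕ → VarIdx n) :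
    toBig K n (∏ j ∈ Finset.range r, (X (i j) : MvPolynomial (VarIdx n) K) ^ a j) =
      orbMon K r (fun j => i j) a := by
  simp [orbMon, toBig]

lemma truncate_orbMon_eq_zero (K : Type*) [Field K] {r n j : ℕ} {μ a : ℕ → ℕ}
    (hj : j < r) (ha : 0 < a j) (hμ : μ j ∉ Finset.Icc 1 n) :
    truncate K n (orbMon K r μ a) = 0 := by
  rw [orbMon, map_prod]
  refine Finset.prod_eq_zero (Finset.mem_range.2 hj) ?_
  rw [map_pow, truncate, aeval_X, dif_neg hμ, zero_pow ha.ne']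

/-- An ideal of `K[X_n]` containing the truncations of the `Inc`-orbit of `m` contains `I_n`. -/
lemma restr_orbitIdeal_le (K : Type*) [Field K] {n : ℕ} {m : MvPolynomial ℕ K}
    {J : Ideal (MvPolynomial (VarIdx n) K)}
    (h : ∀ π : ℕ → ℕ, StrictMono π → truncate K n (rename π m) ∈ J) :
    restr K (orbitIdeal K m) n ≤ J := by
  have hle : orbitIdeal K m ≤ J.comap (truncate K n) := by
    refine Ideal.span_le.2 ?_
    rintro _ ⟨π, hπ, rfl⟩
    exact h π hπ
  intro f hf
  have hfJ := hle hf
  rwa [Ideal.mem_comap, truncate_toBig] at hfJ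

/-- For `n ≥ μ_r`, `I_n` is generated by the monomials
`x_{i_1}^{a_1} ⋯ x_{i_r}^{a_r}` with `μ_1 ≤ i_1`, `i_r ≤ n` and
`i_{j+1} - i_j ≥ μ_{j+1} - μ_j`; for `n < μ_r`, `I_n = 0`. -/
theorem statement0 (K : Type*) [Field K] (r : ℕ) (hr : 1 ≤ r) (μ a : ℕ → ℕ)
    (hμ1 : 1 ≤ μ 0) (hμ : ∀ j, j + 1 < r → μ j < μ (j + 1))
    (ha : ∀ j, j < r → 0 < a j) (n : ℕ) :
    (μ (r - 1) ≤ n →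
      restr K (orbitIdeal K (orbMon K r μ a)) n =
        Ideal.span {q : MvPolynomial (VarIdx n) K | ∃ i : ℕ → VarIdx n,
          μ 0 ≤ (i 0 : ℕ) ∧ ((i (r - 1) : ℕ)) ≤ n ∧
          (∀ j, j + 1 < r → (i j : ℕ) + μ (j + 1) ≤ (i (j + 1) : ℕ) + μ j) ∧
          q = ∏ j ∈ Finset.range r, (X (i j) : MvPolynomial (VarIdx n) K) ^ a j}) ∧
    (n < μ (r - 1) →
      restr K (orbitIdeal K (orbMon K r μ a)) n = ⊥) := by
  refine ⟨fun _ => le_antisymm (restr_orbitIdeal_le K fun π hπ => ?_) ?_, fun hn => ?_⟩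
  · rw [rename_orbMon]
    by_cases hmem : ∀ j < r, π (μ j) ∈ Finset.Icc 1 n
    · let i : ℕ → VarIdx n := fun j => ⟨π (μ (min j (r - 1))), hmem _ (by omega)⟩
      have hi : ∀ j < r, (i j : ℕ) = π (μ j) := fun j hj => by
        simp only [i, min_eq_left (show j ≤ r - 1 by omega)]
      have heq : orbMon K r (π ∘ μ) a = orbMon K r (fun j => i j) a :=
        Finset.prod_congr rfl fun j hj => by
          simp only [hi j (Finset.mem_range.1 hj), Function.comp_apply]
      rw [heq, ← toBig_prod_X_pow, truncate_toBig]
      refine Ideal.subset_span ⟨i, ?_, (Finset.mem_Icc.1 (i (r - 1)).2).2, fun j hj => ?_, rfl⟩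
      · rw [hi 0 hr]
        exact hπ.le_apply
      · rw [hi j (by omega), hi (j + 1) hj]
        have h₁ := hπ.add_le_nat (μ (j + 1) - μ j) (μ j)
        have h₂ := hμ j hj
        rw [Nat.sub_add_cancel h₂.le] at h₁
        omega
    · push Not at hmem
      obtain ⟨j, hj, hjn⟩ := hmem
      rw [truncate_orbMon_eq_zero K hj (ha j hj) hjn]
      exact zero_mem _
  · refine Ideal.span_le.2 ?_
    rintro _ ⟨i, h0, -, hi, rfl⟩
    obtain ⟨π, hπ, hπi⟩ := exists_strictMono_apply_eq (i := fun j => i j) hμ h0 hi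
    refine Ideal.subset_span ⟨π, hπ, ?_⟩
    rw [toBig_prod_X_pow, rename_orbMon]
    exact Finset.prod_congr rfl fun j hj => by
      rw [Function.comp_apply, hπi j (Finset.mem_range.1 hj)]
  · refine le_bot_iff.1 (restr_orbitIdeal_le K fun π hπ => ?_)
    have hr' : r - 1 < r := by omega
    rw [rename_orbMon, truncate_orbMon_eq_zero K hr' (ha _ hr')]
    · exact zero_mem _
    · have := hπ.le_apply (x := μ (r - 1))
      simp only [Function.comp_apply, Finset.mem_Icc]
      omega
end

section
/- If n ≥ μ_r, then A_n = K[X_n]/I_n is a Cohen–Macaulay ring of Krull dimension μ_r − 1. -/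
open MvPolynomial

open RingTheory.Sequence in
/-- The depth (grade) of an ideal `P` on `R`: the supremum of the lengths of regular
sequences on `R` consisting of elements of `P`. -/
noncomputable def depthAt (R : Type*) [CommRing R] (P : Ideal R) : ℕ∞ :=
  sSup {d : ℕ∞ | ∃ rs : List R, (rs.length : ℕ∞) = d ∧ (∀ x ∈ rs, x ∈ P) ∧ IsRegular R rs}

/-- A commutative ring is Cohen–Macaulay if for every maximal ideal `P` the depth of `P`
on `R` equals the Krull dimension of the localization of `R` at `P`. -/
def IsCohenMacaulayRing (R : Type*) [CommRing R] : Prop :=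
  ∀ P : Ideal R, (hP : P.IsMaximal) →
    (depthAt R P : WithBot ℕ∞) = ringKrullDim (@Localization.AtPrime R _ P hP.isPrime)

/-- A list of ring elements is a weakly regular sequence modulo an ideal. -/
def IsWeaklyRegularMod {R : Type*} [CommRing R] : Ideal R → List R → Prop
  | _, [] => True
  | I, f :: fs => (∀ s, f * s ∈ I → s ∈ I) ∧ IsWeaklyRegularMod (I ⊔ Ideal.span {f}) fs

namespace IsWeaklyRegularMod

variable {R : Type*} [CommRing R]

theorem top (fs : List R) : IsWeaklyRegularMod ⊤ fs := by
  induction fs with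
  | nil => trivial
  | cons f fs ih => exact ⟨fun _ _ => trivial, by simpa using ih⟩

theorem sup_span_singleton_congr {I : Ideal R} {f g : R} (h : f - g ∈ I) :
    I ⊔ Ideal.span {f} = I ⊔ Ideal.span {g} := by
  apply le_antisymm <;> refine sup_le le_sup_left ?_ <;>
    rw [Ideal.span_singleton_le_iff_mem, Submodule.mem_sup]
  · exact ⟨_, h, g, Ideal.mem_span_singleton_self g, by ring⟩
  · exact ⟨_, neg_mem h, f, Ideal.mem_span_singleton_self f, by ring⟩

theorem cons_congr {I : Ideal R} {f g : R} {fs : List R} (h : f - g ∈ I)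
    (H : IsWeaklyRegularMod I (g :: fs)) : IsWeaklyRegularMod I (f :: fs) := by
  refine ⟨fun s hs => H.1 s ?_, ?_⟩
  · have := I.sub_mem hs (I.mul_mem_right s h)
    convert this using 1
    ring
  · rw [sup_span_singleton_congr h]
    exact H.2

/-- Weak regularity passes to basic double links. -/
theorem sup_span_mul {Q J : Ideal R} {f : R} {fs : List R} (hQJ : Q ≤ J)
    (hf : ∀ s, f * s ∈ Q → s ∈ Q) (hJ : IsWeaklyRegularMod J fs)
    (hQ : IsWeaklyRegularMod (Q ⊔ Ideal.span {f}) fs) :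
    IsWeaklyRegularMod (Q ⊔ Ideal.span {f} * J) fs := by
  induction fs generalizing Q J with
  | nil => trivial
  | cons g fs ih =>
    have memQ : ∀ {t : R}, t ∈ Q ⊔ Ideal.span {f} ↔ ∃ q ∈ Q, ∃ c, q + f * c = t := by
      intro t
      rw [Submodule.mem_sup]
      simp only [Ideal.mem_span_singleton']
      constructor
      · rintro ⟨q, hq, _, ⟨c, rfl⟩, rfl⟩
        exact ⟨q, hq, c, by ring⟩
      · rintro ⟨q, hq, c, rfl⟩
        exact ⟨q, hq, f * c, ⟨c, by ring⟩, rfl⟩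
    have memJ : ∀ {t : R}, t ∈ Q ⊔ Ideal.span {f} * J ↔ ∃ q ∈ Q, ∃ c ∈ J, q + f * c = t := by
      intro t
      rw [Submodule.mem_sup]
      simp only [Ideal.mem_span_singleton_mul]
      constructor
      · rintro ⟨q, hq, _, ⟨c, hc, rfl⟩, rfl⟩
        exact ⟨q, hq, c, hc, rfl⟩
      · rintro ⟨q, hq, c, hc, rfl⟩
        exact ⟨q, hq, f * c, ⟨c, hc, rfl⟩, rfl⟩
    refine ⟨fun s hs => ?_, ?_⟩
    · obtain ⟨q₁, hq₁, j, hj, e₁⟩ := memJ.1 hs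
      obtain ⟨q, hq, t, rfl⟩ := memQ.1 (hQ.1 s (memQ.2 ⟨q₁, hq₁, j, e₁⟩))
      have h₁ : f * (g * t - j) ∈ Q := by
        have : f * (g * t - j) = q₁ - g * q := by linear_combination -e₁
        rw [this]
        exact Q.sub_mem hq₁ (Q.mul_mem_left _ hq)
      have h₂ : g * t ∈ J := by
        have := J.add_mem (hQJ (hf _ h₁)) hj
        simpa using this
      exact memJ.2 ⟨q, hq, t, hJ.1 t h₂, rfl⟩
    · have key := ih (Q := Q ⊔ Ideal.span {g}) (J := J ⊔ Ideal.span {g})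
        (sup_le_sup_right hQJ _) ?_ hJ.2 ?_
      · convert key using 1
        rw [Ideal.mul_sup]
        apply le_antisymm
        · exact sup_le (sup_le (le_sup_left.trans le_sup_left) (le_sup_left.trans le_sup_right))
            (le_sup_right.trans le_sup_left)
        · refine sup_le (sup_le (le_sup_left.trans le_sup_left) le_sup_right)
            (sup_le (le_sup_right.trans le_sup_left) (Ideal.mul_le_right.trans le_sup_right))
      · intro s hs
        rw [Submodule.mem_sup] at hs
        obtain ⟨q, hq, _, ht, e⟩ := hs
        obtain ⟨t, rfl⟩ := Ideal.mem_span_singleton'.1 ht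
        have h₁ : t ∈ Q ⊔ Ideal.span {f} :=
          hQ.1 t (memQ.2 ⟨-q, neg_mem hq, s, by linear_combination -e⟩)
        obtain ⟨q', hq', t', rfl⟩ := memQ.1 h₁
        have h₂ : f * (s - g * t') ∈ Q := by
          have : f * (s - g * t') = q + g * q' := by linear_combination -e
          rw [this]
          exact Q.add_mem hq (Q.mul_mem_left _ hq')
        rw [Submodule.mem_sup]
        exact ⟨_, hf _ h₂, g * t', Ideal.mem_span_singleton'.2 ⟨t', by ring⟩, by ring⟩
      · have := hQ.2
        rwa [sup_right_comm] at this

theorem sup_span_prod {ι : Type*} {Q : Ideal R} {u : ι → R} {fs : List R} (τ : Finset ι)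
    (hu : ∀ i ∈ τ, ∀ s, u i * s ∈ Q → s ∈ Q)
    (h : ∀ i ∈ τ, IsWeaklyRegularMod (Q ⊔ Ideal.span {u i}) fs) :
    IsWeaklyRegularMod (Q ⊔ Ideal.span {∏ i ∈ τ, u i}) fs := by
  classical
  induction τ using Finset.induction_on with
  | empty => simpa [Ideal.span_singleton_one] using top fs
  | insert i τ hi ih =>
    have key := sup_span_mul (Q := Q) (J := Q ⊔ Ideal.span {∏ i ∈ τ, u i}) (f := u i) le_sup_left
      (hu i (Finset.mem_insert_self i τ))
      (ih (fun j hj => hu j (Finset.mem_insert_of_mem hj))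
        (fun j hj => h j (Finset.mem_insert_of_mem hj))) (h i (Finset.mem_insert_self i τ))
    rw [Finset.prod_insert hi, ← Ideal.span_singleton_mul_span_singleton]
    rwa [Ideal.mul_sup, ← sup_assoc, sup_eq_left.2 (Ideal.mul_le_right : Ideal.span {u i} * Q ≤ Q)]
      at key

theorem sup_span_pow {Q : Ideal R} {f : R} {fs : List R} (hf : ∀ s, f * s ∈ Q → s ∈ Q)
    (h : IsWeaklyRegularMod (Q ⊔ Ideal.span {f}) fs) (k : ℕ) :
    IsWeaklyRegularMod (Q ⊔ Ideal.span {f ^ k}) fs := by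
  simpa using sup_span_prod (u := fun _ => f) (Finset.range k) (fun _ _ => hf) (fun _ _ => h)

theorem getElem_mul_mem {I : Ideal R} {fs : List R} (h : IsWeaklyRegularMod I fs) (i : ℕ)
    (hi : i < fs.length) (s : R) (hs : fs[i] * s ∈ I ⊔ Ideal.ofList (fs.take i)) :
    s ∈ I ⊔ Ideal.ofList (fs.take i) := by
  induction fs generalizing I i with
  | nil => simp at hi
  | cons f fs ih =>
    cases i with
    | zero => simpa using h.1 s (by simpa using hs)
    | succ i =>
      have := ih h.2 i (by simpa using hi)
      simp only [List.getElem_cons_succ, List.take_succ_cons, Ideal.ofList_cons,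
        ← sup_assoc] at hs ⊢
      exact this hs

theorem isWeaklyRegular_quotient {I : Ideal R} {fs : List R} (h : IsWeaklyRegularMod I fs) :
    RingTheory.Sequence.IsWeaklyRegular (R ⧸ I) (fs.map (Ideal.Quotient.mk I)) := by
  refine ⟨fun i hi => ?_⟩
  have hi' : i < fs.length := by simpa using hi
  rw [isSMulRegular_quotient_iff_mem_of_smul_mem]
  intro x hx
  obtain ⟨s, rfl⟩ := Ideal.Quotient.mk_surjective x
  have aux : ∀ t : R, Ideal.Quotient.mk I t ∈
      (Ideal.ofList ((fs.map (Ideal.Quotient.mk I)).take i) • (⊤ : Submodule (R ⧸ I) (R ⧸ I))) ↔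
      t ∈ I ⊔ Ideal.ofList (fs.take i) := by
    intro t
    rw [← List.map_take, ← Ideal.map_ofList, smul_eq_mul, Ideal.mul_top,
      ← Ideal.mem_comap, Ideal.comap_map_of_surjective' _ Ideal.Quotient.mk_surjective,
      Ideal.mk_ker, sup_comm]
  rw [aux]
  apply h.getElem_mul_mem i hi'
  rw [← aux]
  simpa using hx

end IsWeaklyRegularMod

/-- The `k`-th elementary symmetric expression in a finite family of ring elements. -/
def esymmOf {R ι : Type*} [CommRing R] [Fintype ι] (u : ι → R) (k : ℕ) : R :=
  ∑ t ∈ Finset.univ.powersetCard k, ∏ i ∈ t, u i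

/-- The list `[e_d, …, e_1]` of elementary symmetric expressions. -/
def esymmList {R ι : Type*} [CommRing R] [Fintype ι] (u : ι → R) : ℕ → List R
  | 0 => []
  | d + 1 => esymmOf u (d + 1) :: esymmList u d

section Esymm

variable {R ι : Type*} [CommRing R] [Fintype ι]

theorem length_esymmList (u : ι → R) (d : ℕ) : (esymmList u d).length = d := by
  induction d with
  | zero => rfl
  | succ d ih => simp [esymmList, ih]

theorem mem_of_mem_esymmList {u : ι → R} {P : Ideal R} (hu : ∀ i, u i ∈ P) {d : ℕ} :
    ∀ f ∈ esymmList u d, f ∈ P := by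
  induction d with
  | zero => simp [esymmList]
  | succ d ih =>
    intro f hf
    rcases List.mem_cons.1 hf with rfl | hf
    · refine Ideal.sum_mem _ fun t ht => ?_
      have hc := (Finset.mem_powersetCard.1 ht).2
      obtain ⟨i, hi⟩ : t.Nonempty := Finset.card_pos.1 (by omega)
      exact P.mem_of_dvd (Finset.dvd_prod_of_mem u hi) (hu i)
    · exact ih f hf

theorem esymmOf_sub_prod_mem {u : ι → R} {Q : Ideal R} {σ : Finset ι}
    (hu : ∀ i ∉ σ, u i ∈ Q) : esymmOf u σ.card - ∏ i ∈ σ, u i ∈ Q := by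
  classical
  have hσ : σ ∈ (Finset.univ : Finset ι).powersetCard σ.card := by simp
  rw [esymmOf, ← Finset.add_sum_erase _ _ hσ, add_sub_cancel_left]
  refine Ideal.sum_mem _ fun t ht => ?_
  obtain ⟨hne, ht⟩ := Finset.mem_erase.1 ht
  have hc := (Finset.mem_powersetCard.1 ht).2
  have : ¬ t ⊆ σ := fun h => hne (Finset.eq_of_subset_of_card_le h hc.ge)
  obtain ⟨i, hi, hiσ⟩ := Finset.not_subset.1 this
  exact Q.mem_of_dvd (Finset.dvd_prod_of_mem u hi) (hu i hiσ)

/-- Elementary symmetric expressions in the elements of a permutable weakly regular sequence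
form a weakly regular sequence. -/
theorem isWeaklyRegularMod_esymmList {u : ι → R} {Q : Ideal R} {σ : Finset ι} {d : ℕ}
    (hd : σ.card = d) (hu : ∀ i ∉ σ, u i ∈ Q)
    (hreg : ∀ τ ⊆ σ, ∀ i ∈ σ, i ∉ τ → ∀ s, u i * s ∈ Q ⊔ Ideal.span (u '' τ) →
      s ∈ Q ⊔ Ideal.span (u '' τ)) :
    IsWeaklyRegularMod Q (esymmList u d) := by
  classical
  induction d generalizing Q σ with
  | zero => trivial
  | succ d ih =>
    have hreg₀ : ∀ i ∈ σ, ∀ s, u i * s ∈ Q → s ∈ Q := fun i hi s hs => by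
      simpa using hreg ∅ (by simp) i hi (by simp) s (by simpa using hs)
    refine IsWeaklyRegularMod.cons_congr (g := ∏ i ∈ σ, u i)
      (hd ▸ esymmOf_sub_prod_mem hu) ⟨?_, ?_⟩
    · have : ∀ τ ⊆ σ, ∀ s, (∏ i ∈ τ, u i) * s ∈ Q → s ∈ Q := by
        intro τ
        induction τ using Finset.induction_on with
        | empty => simp
        | insert i τ hi ihτ =>
          intro hτ s hs
          rw [Finset.prod_insert hi, mul_assoc] at hs
          exact ihτ ((Finset.subset_insert i τ).trans hτ) s
            (hreg₀ i (hτ (Finset.mem_insert_self i τ)) _ hs)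
      exact this σ subset_rfl
    · refine IsWeaklyRegularMod.sup_span_prod σ hreg₀ fun i hi => ?_
      refine ih (σ := σ.erase i) (by rw [Finset.card_erase_of_mem hi, hd]; rfl) ?_ ?_
      · intro j hj
        by_cases hji : j = i
        · subst hji
          exact Ideal.mem_sup_right (Ideal.mem_span_singleton_self _)
        · exact Ideal.mem_sup_left (hu j fun h => hj (Finset.mem_erase.2 ⟨hji, h⟩))
      · intro τ hτ j hj hjτ s hs
        have e : Q ⊔ Ideal.span {u i} ⊔ Ideal.span (u '' τ) =
            Q ⊔ Ideal.span (u '' ↑(insert i τ)) := by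
          rw [sup_assoc, ← Ideal.span_union, Finset.coe_insert, Set.image_insert_eq,
            Set.insert_eq]
        rw [e] at hs ⊢
        refine hreg _ (Finset.insert_subset hi (hτ.trans (Finset.erase_subset _ _))) j
          (Finset.mem_of_mem_erase hj) ?_ s hs
        simp [Finset.ne_of_mem_erase hj, hjτ]

end Esymm

/-- A monic polynomial in one variable is a nonzerodivisor modulo an ideal generated by
polynomials in the other variables. -/
theorem mem_span_of_aeval_X_mul_mem {K ι : Type*} [Field K] {i : ι}
    {G : Set (MvPolynomial ι K)} (hG : G ⊆ supported K ({i}ᶜ : Set ι)) {g : Polynomial K}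
    (hg : g.Monic) {s : MvPolynomial ι K}
    (hs : Polynomial.aeval (X i : MvPolynomial ι K) g * s ∈ Ideal.span G) :
    s ∈ Ideal.span G := by
  classical
  obtain ⟨e, heX, heC⟩ : ∃ e : MvPolynomial ι K ≃ₐ[K] Polynomial (MvPolynomial {j // j ≠ i} K),
      e (X i) = Polynomial.X ∧ ∀ q, e (rename Subtype.val q) = Polynomial.C q := by
    refine ⟨(renameEquiv K (Equiv.optionSubtypeNe i).symm).trans (optionEquivLeft K _),
      by simp, fun q => ?_⟩
    induction q using MvPolynomial.induction_on with
    | C c => simp [optionEquivLeft_C]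
    | add p q hp hq => simp only [map_add, hp, hq]
    | mul_X p j hp =>
      rw [map_mul, map_mul, hp, rename_X, map_mul]
      congr 1
      have : (Equiv.optionSubtypeNe i).symm j.1 = some j := by
        rw [Equiv.symm_apply_eq]; simp
      simp [this]
  have hran : ∀ p ∈ G, ∃ q : MvPolynomial {j // j ≠ i} K, rename Subtype.val q = p := by
    intro p hp
    have hp' := hG hp
    rw [SetLike.mem_coe, supported_eq_range_rename] at hp'
    obtain ⟨q, rfl⟩ := hp'
    refine ⟨rename (fun j => ⟨j.1, Set.mem_compl_singleton_iff.1 j.2⟩) q, ?_⟩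
    rw [rename_rename]
    rfl
  let Q' : Ideal (MvPolynomial {j // j ≠ i} K) := Ideal.span {b | Polynomial.C b ∈ e '' G}
  have hmap : (Ideal.span G).map e = Q'.map Polynomial.C := by
    rw [Ideal.map_span, Ideal.map_span]
    congr 1
    ext y
    constructor
    · rintro ⟨p, hp, rfl⟩
      obtain ⟨q, rfl⟩ := hran p hp
      exact ⟨q, ⟨_, hp, heC q⟩, (heC q).symm⟩
    · rintro ⟨b, hb, rfl⟩
      exact hb
  have hmem : ∀ p, p ∈ Ideal.span G ↔ e p ∈ Q'.map Polynomial.C := by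
    intro p
    rw [← hmap]
    refine ⟨fun h => Ideal.mem_map_of_mem e h, fun h => ?_⟩
    obtain ⟨x, hx, hxp⟩ := (Ideal.mem_map_iff_of_surjective e e.surjective).1 h
    rwa [← e.injective hxp]
  rw [hmem] at hs ⊢
  have hker : ∀ y, y ∈ Q'.map Polynomial.C ↔
      Polynomial.mapRingHom (Ideal.Quotient.mk Q') y = 0 := by
    intro y
    rw [← RingHom.mem_ker, Polynomial.ker_mapRingHom, Ideal.mk_ker]
  rw [hker] at hs ⊢
  rw [map_mul, map_mul] at hs
  have hmon : (Polynomial.mapRingHom (Ideal.Quotient.mk Q')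
      (e (Polynomial.aeval (X i : MvPolynomial ι K) g))).Monic := by
    rw [← AlgEquiv.coe_toAlgHom, ← Polynomial.aeval_algHom_apply, AlgEquiv.coe_toAlgHom, heX,
      Polynomial.coe_mapRingHom]
    refine Polynomial.Monic.map _ ?_
    have : Polynomial.aeval (Polynomial.X : Polynomial (MvPolynomial {j // j ≠ i} K)) g =
        g.map (algebraMap K _) := Polynomial.aeval_X_left_eq_map g
    rw [this]
    exact hg.map _
  exact hmon.mul_right_eq_zero_iff.1 hs

section OrbitIdeal

variable (K : Type*) [Field K] (μ a : ℕ → ℕ) (n : ℕ)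

/-- The variable `x_j` of `K[X_n]`, which is zero for `j` outside `{1, …, n}`. -/
noncomputable def finVar (j : ℕ) : MvPolynomial (VarIdx n) K :=
  if h : j ∈ Finset.Icc 1 n then X ⟨j, h⟩ else 0

/-- The monomials in the `Inc`-orbit of `x_{μ 0}^{a 0} ⋯ x_{μ (r-1)}^{a (r-1)}` which only
involve variables of index at most `m`. -/
def orbitGens (r m : ℕ) : Set (MvPolynomial (VarIdx n) K) :=
  {p | ∃ π : ℕ → ℕ, StrictMono π ∧ (∀ j < r, π (μ j) ≤ m) ∧
    p = ∏ j ∈ Finset.range r, finVar K n (π (μ j)) ^ a j}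

variable {K μ a n}

theorem StrictMono.add_sub_le {π : ℕ → ℕ} (hπ : StrictMono π) {k l : ℕ} (h : k ≤ l) :
    π k + (l - k) ≤ π l := by
  induction l, h using Nat.le_induction with
  | base => simp
  | succ l h ih => have : π l < π (l + 1) := hπ (Nat.lt_succ_self l); omega

theorem le_of_forall_lt_succ {r i j : ℕ} (hμ : ∀ j, j + 1 < r → μ j < μ (j + 1)) (hij : i ≤ j)
    (hj : j < r) : μ i ≤ μ j := by
  induction j, hij using Nat.le_induction with
  | base => rfl
  | succ j h ih => exact (ih (by omega)).trans (hμ j hj).le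

theorem orbitGens_succ_subset_supported (r m : ℕ) (i : VarIdx n) (hi : m < i.1) :
    orbitGens K μ a n r m ⊆ supported K ({i}ᶜ : Set (VarIdx n)) := by
  rintro _ ⟨π, -, hm, rfl⟩
  refine Subalgebra.prod_mem _ fun j hj => Subalgebra.pow_mem _ ?_ _
  have := hm j (Finset.mem_range.1 hj)
  unfold finVar
  split_ifs with h
  · refine X_mem_supported.2 ?_
    rw [Set.mem_compl_singleton_iff]
    rintro rfl
    simp at hi
    omega
  · exact Subalgebra.zero_mem _

theorem span_orbitGens_zero (m : ℕ) : Ideal.span (orbitGens K μ a n 0 m) = ⊤ :=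
  (Ideal.eq_top_iff_one _).2 (Ideal.subset_span ⟨id, strictMono_id, by simp, by simp⟩)

theorem span_orbitGens_eq_bot {t m : ℕ} (h : m < μ t) :
    Ideal.span (orbitGens K μ a n (t + 1) m) = ⊥ := by
  rw [Ideal.span_eq_bot]
  rintro _ ⟨π, hπ, hm, -⟩
  have := hm t (Nat.lt_succ_self t)
  have := hπ.le_apply (x := μ t)
  omega

theorem span_orbitGens_succ_le {t m : ℕ} (hμ : ∀ j, j + 1 < t + 1 → μ j < μ (j + 1)) :
    Ideal.span (orbitGens K μ a n (t + 1) m) ≤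
      Ideal.span (orbitGens K μ a n t (m + 1 - (μ t - μ (t - 1)))) := by
  rw [Ideal.span_le]
  rintro _ ⟨π, hπ, hm, rfl⟩
  rw [Finset.prod_range_succ]
  refine Ideal.mul_mem_right _ _ (Ideal.subset_span ⟨π, hπ, fun j hj => ?_, rfl⟩)
  have h₁ := hπ.add_sub_le (le_of_forall_lt_succ hμ hj.le (Nat.lt_succ_self t))
  have h₂ := hm t (Nat.lt_succ_self t)
  have h₃ := le_of_forall_lt_succ hμ (i := j) (j := t - 1) (by omega) (by omega)
  omega

theorem span_orbitGens_succ_succ {t m : ℕ} (hμ : ∀ j, j + 1 < t + 1 → μ j < μ (j + 1))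
    (hm : μ t ≤ m + 1) :
    Ideal.span (orbitGens K μ a n (t + 1) (m + 1)) =
      Ideal.span (orbitGens K μ a n (t + 1) m) ⊔ Ideal.span {finVar K n (m + 1) ^ a t} *
        Ideal.span (orbitGens K μ a n t (m + 1 - (μ t - μ (t - 1)))) := by
  have mono : ∀ j < t, μ j ≤ μ (t - 1) := fun j hj =>
    le_of_forall_lt_succ hμ (by omega) (by omega)
  apply le_antisymm
  · rw [Ideal.span_le]
    rintro _ ⟨π, hπ, hle, rfl⟩
    have h₂ := hle t (Nat.lt_succ_self t)
    rcases h₂.lt_or_eq with h | h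
    · refine Ideal.mem_sup_left (Ideal.subset_span ⟨π, hπ, fun j hj => ?_, rfl⟩)
      have := hπ.monotone (le_of_forall_lt_succ hμ (Nat.lt_succ_iff.1 hj) (Nat.lt_succ_self t))
      omega
    · rw [Finset.prod_range_succ, h, mul_comm (Finset.prod _ _)]
      refine Ideal.mem_sup_right (Ideal.mul_mem_mul (Ideal.mem_span_singleton_self _)
        (Ideal.subset_span ⟨π, hπ, fun j hj => ?_, rfl⟩))
      have h₁ := hπ.add_sub_le (le_of_forall_lt_succ hμ hj.le (Nat.lt_succ_self t))
      have h₃ := mono j hj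
      omega
  · refine sup_le (Ideal.span_mono ?_) ?_
    · rintro _ ⟨π, hπ, hle, rfl⟩
      exact ⟨π, hπ, fun j hj => (hle j hj).trans (Nat.le_succ m), rfl⟩
    · rw [Ideal.span_mul_span', Ideal.span_le]
      rintro _ ⟨_, rfl, _, ⟨π, hπ, hle, rfl⟩, rfl⟩
      let ρ : ℕ → ℕ := fun k =>
        if 0 < t ∧ k ≤ μ (t - 1) then π k else m + 1 + k - μ t
      have hlast : 0 < t → π (μ (t - 1)) ≤ m + 1 - (μ t - μ (t - 1)) ∧ μ (t - 1) < μ t := by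
        intro ht
        refine ⟨hle _ (by omega), ?_⟩
        have := hμ (t - 1) (by omega)
        rwa [Nat.sub_add_cancel ht] at this
      have hρ : StrictMono ρ := by
        refine strictMono_nat_of_lt_succ fun k => ?_
        simp only [ρ]
        split_ifs with h₁ h₂ h₂
        · exact hπ (Nat.lt_succ_self k)
        · have := hlast h₁.1
          have : k = μ (t - 1) := by omega
          subst this
          omega
        · omega
        · omega
      have hρt : ρ (μ t) = m + 1 := by
        simp only [ρ]
        split_ifs with h
        · have := hlast h.1
          omega
        · omega
      have hρj : ∀ j < t, ρ (μ j) = π (μ j) := fun j hj =>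
        if_pos ⟨by omega, mono j hj⟩
      refine Ideal.subset_span ⟨ρ, hρ, fun j hj => ?_, ?_⟩
      · rw [← hρt]
        exact hρ.monotone (le_of_forall_lt_succ hμ (Nat.lt_succ_iff.1 hj) (Nat.lt_succ_self t))
      · rw [Finset.prod_range_succ, hρt, mul_comm (Finset.prod _ _)]
        congr 1
        exact Finset.prod_congr rfl fun j hj => by rw [hρj j (Finset.mem_range.1 hj)]

theorem X_dvd_aeval {ι : Type*} {g : Polynomial K} (hg : Polynomial.X ∣ g) (i : ι) :
    (X i : MvPolynomial ι K) ∣ Polynomial.aeval (X i) g := by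
  obtain ⟨q, rfl⟩ := hg
  simp

theorem isWeaklyRegularMod_span_X {ι : Type*} [Fintype ι] [DecidableEq ι] {g : ι → Polynomial K}
    (hg : ∀ i, (g i).Monic) (hX : ∀ i, Polynomial.X ∣ g i) (Z : Finset ι) :
    IsWeaklyRegularMod (Ideal.span (X '' (Z : Set ι) : Set (MvPolynomial ι K)))
      (esymmList (fun i => Polynomial.aeval (X i) (g i)) Zᶜ.card) := by
  refine isWeaklyRegularMod_esymmList (σ := Zᶜ) rfl (fun i hi => ?_) fun τ _ i hi hiτ s hs => ?_
  · exact Ideal.mem_of_dvd _ (X_dvd_aeval (hX i) i)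
      (Ideal.subset_span ⟨i, by simpa using hi, rfl⟩)
  · rw [← Ideal.span_union] at hs ⊢
    refine mem_span_of_aeval_X_mul_mem ?_ (hg i) hs
    rintro _ (⟨j, hj, rfl⟩ | ⟨j, hj, rfl⟩)
    · refine X_mem_supported.2 (Set.mem_compl_singleton_iff.2 ?_)
      rintro rfl
      exact Finset.mem_compl.1 hi hj
    · have hji : j ≠ i := by rintro rfl; exact hiτ hj
      have hj' : (X j : MvPolynomial ι K) ∈ supported K ({i}ᶜ : Set ι) :=
        X_mem_supported.2 (Set.mem_compl_singleton_iff.2 hji)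
      exact (Algebra.adjoin_le (Set.singleton_subset_iff.2 hj') :
        Algebra.adjoin K {X j} ≤ _) (Polynomial.aeval_mem_adjoin_singleton K (X j))

theorem isWeaklyRegularMod_orbitGens {g : VarIdx n → Polynomial K}
    (hg : ∀ i, (g i).Monic) (hX : ∀ i, Polynomial.X ∣ g i) (hμ1 : 1 ≤ μ 0) (r : ℕ)
    (hμ : ∀ j, j + 1 < r → μ j < μ (j + 1)) (m : ℕ) (hmn : m ≤ n) (Z : Finset (VarIdx n))
    (hZ : ∀ z ∈ Z, m < z.1) (d : ℕ)
    (hd : r = 0 ∨ μ (r - 1) ≤ m + 1 ∧ Z.card + m + 1 + d = n + μ (r - 1)) :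
    IsWeaklyRegularMod (Ideal.span (orbitGens K μ a n r m) ⊔ Ideal.span (X '' (Z : Set _)))
      (esymmList (fun i => Polynomial.aeval (X i) (g i)) d) := by
  classical
  induction r generalizing m Z d with
  | zero =>
    rw [span_orbitGens_zero, top_sup_eq]
    exact IsWeaklyRegularMod.top _
  | succ t iht =>
    simp only [Nat.succ_ne_zero, false_or, Nat.add_sub_cancel] at hd
    have base : ∀ (m : ℕ) (Z : Finset (VarIdx n)), m < μ t → μ t ≤ m + 1 ∧ Z.card + m + 1 + d = n + μ t →
          IsWeaklyRegularMod (Ideal.span (orbitGens K μ a n (t + 1) m) ⊔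
            Ideal.span (X '' (Z : Set (VarIdx n))))
            (esymmList (fun i => Polynomial.aeval (X i) (g i)) d) := by
      intro m Z h hd
      rw [span_orbitGens_eq_bot h, bot_sup_eq]
      convert isWeaklyRegularMod_span_X hg hX Z
      rw [Finset.card_compl]
      simp
      omega
    have hμt : 1 ≤ μ t := hμ1.trans (le_of_forall_lt_succ hμ (Nat.zero_le t) (Nat.lt_succ_self t))
    induction m generalizing Z with
    | zero => exact base 0 Z (by omega) hd
    | succ m ihm =>
      by_cases hlt : m + 1 < μ t
      · exact base _ Z hlt hd
      have hmem : m + 1 ∈ Finset.Icc 1 n := by simp; omega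
      let i : VarIdx n := ⟨m + 1, hmem⟩
      have hx : finVar K n (m + 1) = X i := by simp only [finVar, dif_pos hmem, i]
      have hiZ : i ∉ Z := fun h => absurd (hZ i h) (by simp [i])
      set Q := Ideal.span (orbitGens K μ a n (t + 1) m) ⊔ Ideal.span (X '' (Z : Set _)) with hQ
      set J := Ideal.span (orbitGens K μ a n t (m + 1 - (μ t - μ (t - 1)))) ⊔
        Ideal.span (X '' (Z : Set _)) with hJ
      have hEq : Ideal.span (orbitGens K μ a n (t + 1) (m + 1)) ⊔
          Ideal.span (X '' (Z : Set _)) = Q ⊔ Ideal.span {X i ^ a t} * J := by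
        rw [span_orbitGens_succ_succ hμ (by omega), hx, hQ, hJ, Ideal.mul_sup]
        apply le_antisymm
        · exact sup_le (sup_le (le_sup_left.trans le_sup_left) (le_sup_left.trans le_sup_right))
            (le_sup_right.trans le_sup_left)
        · exact sup_le (sup_le (le_sup_left.trans le_sup_left) le_sup_right)
            (sup_le (le_sup_right.trans le_sup_left) (Ideal.mul_le_right.trans le_sup_right))
      have hreg : ∀ k s, X i ^ k * s ∈ Q → s ∈ Q := by
        intro k s hs
        rw [hQ, ← Ideal.span_union] at hs ⊢
        refine mem_span_of_aeval_X_mul_mem (i := i) (g := Polynomial.X ^ k) ?_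
          (Polynomial.monic_X_pow k) (by simpa using hs)
        refine Set.union_subset (orbitGens_succ_subset_supported _ _ i (Nat.lt_succ_self m)) ?_
        rintro _ ⟨j, hj, rfl⟩
        refine X_mem_supported.2 (Set.mem_compl_singleton_iff.2 ?_)
        rintro rfl
        exact hiZ hj
      rw [hEq]
      refine IsWeaklyRegularMod.sup_span_mul
        (sup_le_sup_right (span_orbitGens_succ_le hμ) _) (hreg _) ?_ ?_
      · refine iht (fun j hj => hμ j (by omega)) _ (by omega) Z (fun z hz => ?_) d ?_
        · have := hZ z hz
          omega
        · rcases Nat.eq_zero_or_pos t with ht | ht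
          · exact Or.inl ht
          · have := hμ (t - 1) (by omega)
            rw [Nat.sub_add_cancel ht] at this
            exact Or.inr (by omega)
      · refine IsWeaklyRegularMod.sup_span_pow (fun s hs => hreg 1 s (by simpa using hs)) ?_ _
        have := ihm (by omega) (insert i Z) (fun z hz => ?_) (by
          rw [Finset.card_insert_of_notMem hiZ]; omega)
        · rwa [Finset.coe_insert, Set.image_insert_eq, Set.insert_eq, Ideal.span_union,
            sup_comm (Ideal.span {X i}), ← sup_assoc] at this
        · rcases Finset.mem_insert.1 hz with rfl | hz
          · exact Nat.lt_succ_self m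
          · exact (Nat.lt_succ_self m).trans (hZ z hz)

end OrbitIdeal

section OrbitQuotient

variable {K : Type*} [Field K] {μ a : ℕ → ℕ} {n r : ℕ}

theorem le_apply_of_forall_lt_succ (hμ1 : 1 ≤ μ 0) (hμ : ∀ j, j + 1 < r → μ j < μ (j + 1))
    {j : ℕ} (hj : j < r) : 1 ≤ μ j :=
  hμ1.trans (le_of_forall_lt_succ hμ (Nat.zero_le j) hj)

theorem restr_orbitIdeal_eq (hμ1 : 1 ≤ μ 0) (hμ : ∀ j, j + 1 < r → μ j < μ (j + 1))
    (ha : ∀ j, j < r → 0 < a j) :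
    restr K (orbitIdeal K (orbMon K r μ a)) n = Ideal.span (orbitGens K μ a n r n) := by
  let φ : MvPolynomial ℕ K →ₐ[K] MvPolynomial (VarIdx n) K := aeval (finVar K n)
  have hφ : ∀ p, φ (toBig K n p) = p := by
    intro p
    simp only [φ, toBig, aeval_rename]
    convert aeval_X_left_apply p using 2
    congr 1
    funext i
    simp only [Function.comp, finVar, dif_pos i.2]
  apply le_antisymm
  · intro p hp
    rw [← hφ p]
    have h₁ : orbitIdeal K (orbMon K r μ a) ≤
        (Ideal.span (orbitGens K μ a n r n)).comap φ := by
      rw [orbitIdeal, Ideal.span_le]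
      rintro _ ⟨π, hπ, rfl⟩
      simp only [SetLike.mem_coe, Ideal.mem_comap]
      have e : φ (rename π (orbMon K r μ a)) =
          ∏ j ∈ Finset.range r, finVar K n (π (μ j)) ^ a j := by
        simp [φ, orbMon]
      rw [e]
      by_cases h : ∀ j < r, π (μ j) ≤ n
      · exact Ideal.subset_span ⟨π, hπ, h, rfl⟩
      · push Not at h
        obtain ⟨j, hj, hn⟩ := h
        rw [Finset.prod_eq_zero (Finset.mem_range.2 hj)]
        · exact zero_mem _
        · rw [finVar, dif_neg (by simp; omega), zero_pow (ha j hj).ne']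
    exact h₁ hp
  · rw [Ideal.span_le]
    rintro _ ⟨π, hπ, hle, rfl⟩
    refine Ideal.subset_span ⟨π, hπ, ?_⟩
    simp only [orbMon, map_prod, map_pow, rename_X, toBig]
    refine Finset.prod_congr rfl fun j hj => ?_
    have hj := Finset.mem_range.1 hj
    have h1 := le_apply_of_forall_lt_succ hμ1 hμ hj
    have h2 := hπ.le_apply (x := μ j)
    rw [finVar, dif_pos (Finset.mem_Icc.2 ⟨h1.trans h2, hle j hj⟩), rename_X]

theorem span_orbitGens_ne_top (hr : 1 ≤ r) (ha : ∀ j, j < r → 0 < a j) (m : ℕ) :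
    Ideal.span (orbitGens K μ a n r m) ≠ ⊤ := by
  have h : Ideal.span (orbitGens K μ a n r m) ≤
      RingHom.ker (constantCoeff : MvPolynomial (VarIdx n) K →+* K) := by
    rw [Ideal.span_le]
    rintro _ ⟨π, -, -, rfl⟩
    rw [SetLike.mem_coe, RingHom.mem_ker, map_prod]
    refine Finset.prod_eq_zero (Finset.mem_range.2 hr) ?_
    rw [map_pow, finVar]
    split_ifs <;> simp [(ha 0 hr).ne']
  exact fun e => RingHom.ker_ne_top _ (top_le_iff.1 (e ▸ h))

open Classical in
theorem card_X_notMem_lt (hr : 1 ≤ r) (hμ1 : 1 ≤ μ 0)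
    (hμ : ∀ j, j + 1 < r → μ j < μ (j + 1)) {q : Ideal (MvPolynomial (VarIdx n) K)}
    (hq : q.IsPrime) (hle : Ideal.span (orbitGens K μ a n r n) ≤ q) :
    (Finset.univ.filter fun i : VarIdx n => X i ∉ q).card < μ (r - 1) := by
  by_contra! hcard
  set W := (Finset.univ.filter fun i : VarIdx n => X i ∉ q).map (Function.Embedding.subtype _)
    with hW
  have hWcard : μ (r - 1) ≤ W.card := by rwa [hW, Finset.card_map]
  have hWn : ∀ k ∈ W, 1 ≤ k ∧ k ≤ n := by
    intro k hk
    obtain ⟨i, -, rfl⟩ := Finset.mem_map.1 hk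
    exact Finset.mem_Icc.1 i.2
  let p : ℕ → Prop := fun k => k ∈ W ∨ k = 0 ∨ n < k
  have hinf : (Set.ofPred p).Infinite := by
    refine Set.infinite_of_not_bddAbove ?_
    rintro ⟨b, hb⟩
    have : b + n + 1 ≤ b := hb (show p _ from Or.inr (Or.inr (by omega)))
    omega
  have hπ : StrictMono (Nat.nth p) := Nat.nth_strictMono hinf
  have hcount : W.card + 1 ≤ Nat.count p (n + 1) := by
    rw [Nat.count_eq_card_filter_range, ← Finset.card_insert_of_notMem (a := 0) (s := W)
      (fun h => absurd (hWn 0 h).1 (by omega))]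
    refine Finset.card_le_card fun k hk => ?_
    rw [Finset.mem_filter, Finset.mem_range]
    rcases Finset.mem_insert.1 hk with rfl | hk
    · exact ⟨by omega, Or.inr (Or.inl rfl)⟩
    · exact ⟨by have := hWn k hk; omega, Or.inl hk⟩
  have hnth : ∀ k, 1 ≤ k → k ≤ W.card → Nat.nth p k ≤ n ∧ Nat.nth p k ∈ W := by
    intro k h1 hk
    have hlt : Nat.nth p k < n + 1 := Nat.nth_lt_of_lt_count (by omega)
    refine ⟨by omega, ?_⟩
    rcases Nat.nth_mem_of_infinite hinf k with h | h | h
    · exact h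
    · have := hπ.le_apply (x := k)
      omega
    · omega
  have hk : ∀ j < r, 1 ≤ μ j ∧ μ j ≤ W.card := fun j hj =>
    ⟨le_apply_of_forall_lt_succ hμ1 hμ hj,
      (le_of_forall_lt_succ hμ (by omega) (by omega)).trans hWcard⟩
  have hmem : ∏ j ∈ Finset.range r, finVar K n (Nat.nth p (μ j)) ^ a j ∈ q :=
    hle (Ideal.subset_span ⟨Nat.nth p, hπ, fun j hj => (hnth _ (hk j hj).1 (hk j hj).2).1, rfl⟩)
  obtain ⟨j, hj, hmem⟩ := (hq.prod_mem_iff).1 hmem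
  have hj := Finset.mem_range.1 hj
  obtain ⟨i, hi, hi'⟩ := Finset.mem_map.1 (hnth _ (hk j hj).1 (hk j hj).2).2
  have hX := hq.mem_of_pow_mem _ hmem
  rw [← hi', finVar, dif_pos (by exact i.2)] at hX
  exact (Finset.mem_filter.1 hi).2 hX

end OrbitQuotient

theorem ringKrullDim_le_of_forall_quotient_le {A : Type*} [CommRing A] {d : WithBot ℕ∞}
    (h : ∀ p : Ideal A, p.IsPrime → ringKrullDim (A ⧸ p) ≤ d) : ringKrullDim A ≤ d := by
  refine iSup_le fun l => ?_
  refine le_trans ?_ (h l.head.asIdeal l.head.2)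
  rw [ringKrullDim_quotient]
  let l' : LTSeries (PrimeSpectrum.zeroLocus (l.head.asIdeal : Set A)) :=
    { length := l.length
      toFun := fun i => ⟨l i, l.monotone (Fin.zero_le i)⟩
      step := fun i => l.step i }
  exact le_iSup (fun l : LTSeries _ => ((l.length : ℕ∞) : WithBot ℕ∞)) l'

open Classical in
/-- The dimension of a quotient of a polynomial ring is at most the maximal number of variables
avoided by a prime containing the ideal. -/
theorem ringKrullDim_quotient_le_of_card {K ι : Type*} [Field K] [Fintype ι]
    {I : Ideal (MvPolynomial ι K)} {d : ℕ}
    (h : ∀ q : Ideal (MvPolynomial ι K), q.IsPrime → I ≤ q →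
      (Finset.univ.filter fun i => X i ∉ q).card ≤ d) :
    ringKrullDim (MvPolynomial ι K ⧸ I) ≤ d := by
  refine ringKrullDim_le_of_forall_quotient_le fun p hp => ?_
  let q := p.comap (Ideal.Quotient.mk I)
  have hIq : I ≤ q := by
    rw [← Ideal.mk_ker (I := I)]
    exact Ideal.comap_mono bot_le
  let σ := {i : ι // X i ∉ q}
  let π : MvPolynomial ι K →ₐ[K] (MvPolynomial ι K ⧸ I) ⧸ p :=
    (Ideal.Quotient.mkₐ K p).comp (Ideal.Quotient.mkₐ K I)
  have hsurj : Function.Surjective (π.comp (rename (Subtype.val : σ → ι))) := by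
    have hπ : Function.Surjective π :=
      (Ideal.Quotient.mkₐ_surjective K p).comp (Ideal.Quotient.mkₐ_surjective K I)
    intro y
    obtain ⟨s, rfl⟩ := hπ y
    induction s using MvPolynomial.induction_on with
    | C c => exact ⟨C c, by simp⟩
    | add s t hs ht =>
      obtain ⟨s', hs⟩ := hs
      obtain ⟨t', ht⟩ := ht
      exact ⟨s' + t', by rw [map_add, map_add, hs, ht]⟩
    | mul_X s i hs =>
      obtain ⟨s', hs⟩ := hs
      by_cases hi : X i ∈ q
      · have : π (X i) = 0 := Ideal.Quotient.eq_zero_iff_mem.2 hi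
        exact ⟨0, by rw [map_mul, this, mul_zero, map_zero]⟩
      · exact ⟨s' * X ⟨i, hi⟩, by rw [map_mul, map_mul, hs]; simp⟩
  refine (ringKrullDim_le_of_surjective (π.comp (rename (Subtype.val : σ → ι))).toRingHom
    hsurj).trans ?_
  rw [MvPolynomial.ringKrullDim_of_isNoetherianRing, ringKrullDim_eq_zero_of_field, zero_add]
  have := h q (hp.comap _) hIq
  rw [Nat.card_eq_fintype_card, Fintype.card_subtype]
  exact_mod_cast this

open RingTheory.Sequence in
theorem depthAt_le_height {A : Type*} [CommRing A] [IsNoetherianRing A] (P : Ideal A)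
    [hP : P.IsPrime] : depthAt A P ≤ P.height := by
  refine sSup_le ?_
  rintro _ ⟨rs, rfl, hrs, hreg⟩
  have : IsNoetherianRing (Localization.AtPrime P) :=
    IsLocalization.isNoetherianRing P.primeCompl _ inferInstance
  have hreg' := hreg.toIsWeaklyRegular.isRegular_of_isLocalization_of_mem
    (Localization.AtPrime P) P hrs
  have hdim := ringKrullDim_add_length_eq_ringKrullDim_of_isRegular _ hreg'
  have hne : Nontrivial (Localization.AtPrime P ⧸
      Ideal.ofList (rs.map (algebraMap A (Localization.AtPrime P)))) := by
    refine Ideal.Quotient.nontrivial_iff.2 fun h => hreg'.top_ne_smul ?_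
    rw [h, smul_eq_mul, Ideal.top_mul]
  have h0 := ringKrullDim_nonneg_of_nontrivial (R := Localization.AtPrime P ⧸
      Ideal.ofList (rs.map (algebraMap A (Localization.AtPrime P))))
  have hle : ((rs.length : ℕ∞) : WithBot ℕ∞) ≤ P.height := by
    rw [← IsLocalization.AtPrime.ringKrullDim_eq_height P (Localization.AtPrime P), ← hdim,
      List.length_map]
    exact le_add_of_nonneg_left h0
  exact_mod_cast hle

theorem le_depthAt_of_isWeaklyRegular {A : Type*} [CommRing A] {P : Ideal A} (hP : P ≠ ⊤)
    {rs : List A} (hrs : ∀ x ∈ rs, x ∈ P) (hreg : RingTheory.Sequence.IsWeaklyRegular A rs) :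
    (rs.length : ℕ∞) ≤ depthAt A P := by
  refine le_sSup ⟨rs, rfl, hrs, hreg, fun h => hP (top_le_iff.1 ?_)⟩
  rw [h, smul_eq_mul, Ideal.mul_top]
  exact Ideal.span_le.2 hrs

theorem exists_monic_X_dvd_aeval_mem {K A : Type*} [Field K] [CommRing A] [Algebra K A]
    [Algebra.FiniteType K A] (P : Ideal A) [hP : P.IsMaximal] (x : A) :
    ∃ g : Polynomial K, g.Monic ∧ Polynomial.X ∣ g ∧ Polynomial.aeval x g ∈ P := by
  let _ : Field (A ⧸ P) := Ideal.Quotient.field P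
  have : Module.Finite K (A ⧸ P) := finite_of_finite_type_of_isJacobsonRing K (A ⧸ P)
  obtain ⟨g, hg, hgx⟩ := IsIntegral.of_finite K (Ideal.Quotient.mk P x)
  refine ⟨Polynomial.X * g, Polynomial.monic_X.mul hg, dvd_mul_right _ _, ?_⟩
  rw [map_mul]
  refine P.mul_mem_left _ (Ideal.Quotient.eq_zero_iff_mem.1 ?_)
  have : (Ideal.Quotient.mkₐ K P) (Polynomial.aeval x g) = 0 := by
    rw [← Polynomial.aeval_algHom_apply]
    exact hgx
  exact this

theorem depthAt_orbitGens_ge {K : Type*} [Field K] {μ a : ℕ → ℕ} {n r : ℕ} (hr : 1 ≤ r)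
    (hμ1 : 1 ≤ μ 0) (hμ : ∀ j, j + 1 < r → μ j < μ (j + 1)) (hn : μ (r - 1) ≤ n)
    (P : Ideal (MvPolynomial (VarIdx n) K ⧸ Ideal.span (orbitGens K μ a n r n)))
    [hP : P.IsMaximal] :
    ((μ (r - 1) - 1 : ℕ) : ℕ∞) ≤
      depthAt (MvPolynomial (VarIdx n) K ⧸ Ideal.span (orbitGens K μ a n r n)) P := by
  have hQ : (P.comap (Ideal.Quotient.mk _)).IsMaximal :=
    Ideal.comap_isMaximal_of_surjective _ Ideal.Quotient.mk_surjective
  choose g hg hX hmem using fun i : VarIdx n =>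
    exists_monic_X_dvd_aeval_mem (K := K) (P.comap (Ideal.Quotient.mk _)) (X i)
  have h1 : 1 ≤ μ (r - 1) := le_apply_of_forall_lt_succ hμ1 hμ (by omega)
  have h := isWeaklyRegularMod_orbitGens (a := a) hg hX hμ1 r hμ n le_rfl ∅ (by simp)
    (μ (r - 1) - 1) (Or.inr ⟨by omega, by simp; omega⟩)
  simp only [Finset.coe_empty, Set.image_empty, Ideal.span_empty, sup_bot_eq] at h
  have := le_depthAt_of_isWeaklyRegular hP.ne_top (fun x hx => ?_) h.isWeaklyRegular_quotient
  · rwa [List.length_map, length_esymmList] at this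
  · obtain ⟨f, hf, rfl⟩ := List.mem_map.1 hx
    exact mem_of_mem_esymmList hmem f hf

/-- For `n ≥ μ_r`, `A_n = K[X_n]/I_n` is Cohen–Macaulay
of Krull dimension `μ_r - 1`. -/
theorem statement2 (K : Type*) [Field K] (r : ℕ) (hr : 1 ≤ r) (μ a : ℕ → ℕ)
    (hμ1 : 1 ≤ μ 0) (hμ : ∀ j, j + 1 < r → μ j < μ (j + 1))
    (ha : ∀ j, j < r → 0 < a j) (n : ℕ) (hn : μ (r - 1) ≤ n) :
    IsCohenMacaulayRing
        (MvPolynomial (VarIdx n) K ⧸ restr K (orbitIdeal K (orbMon K r μ a)) n) ∧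
      ringKrullDim
          (MvPolynomial (VarIdx n) K ⧸ restr K (orbitIdeal K (orbMon K r μ a)) n) =
        ((μ (r - 1) - 1 : ℕ) : WithBot (WithTop ℕ)) := by
  rw [restr_orbitIdeal_eq hμ1 hμ ha]
  have hdim : ringKrullDim
      (MvPolynomial (VarIdx n) K ⧸ Ideal.span (orbitGens K μ a n r n)) ≤
        ((μ (r - 1) - 1 : ℕ) : WithBot ℕ∞) :=
    ringKrullDim_quotient_le_of_card fun q hq hle =>
      Nat.le_sub_one_of_lt (card_X_notMem_lt hr hμ1 hμ hq hle)
  have hnt : Nontrivial (MvPolynomial (VarIdx n) K ⧸ Ideal.span (orbitGens K μ a n r n)) :=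
    Ideal.Quotient.nontrivial_iff.2 (span_orbitGens_ne_top hr ha n)
  have hge : ∀ P : Ideal (MvPolynomial (VarIdx n) K ⧸ Ideal.span (orbitGens K μ a n r n)),
      P.IsMaximal → ((μ (r - 1) - 1 : ℕ) : ℕ∞) ≤ depthAt _ P ∧ depthAt _ P ≤ P.height ∧
        (P.height : WithBot ℕ∞) ≤ ringKrullDim
          (MvPolynomial (VarIdx n) K ⧸ Ideal.span (orbitGens K μ a n r n)) := fun P hP =>
    ⟨depthAt_orbitGens_ge hr hμ1 hμ hn P, depthAt_le_height P,
      Ideal.height_le_ringKrullDim_of_ne_top hP.ne_top⟩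
  constructor
  · intro P hP
    obtain ⟨h₁, h₂, h₃⟩ := hge P hP
    have := hP.isPrime
    rw [IsLocalization.AtPrime.ringKrullDim_eq_height P (Localization.AtPrime P)]
    refine le_antisymm (WithBot.coe_le_coe.2 h₂) (h₃.trans (hdim.trans ?_))
    exact WithBot.coe_le_coe.2 h₁
  · obtain ⟨P, hP⟩ := Ideal.exists_maximal
      (MvPolynomial (VarIdx n) K ⧸ Ideal.span (orbitGens K μ a n r n))
    obtain ⟨h₁, h₂, h₃⟩ := hge P hP
    refine le_antisymm hdim (le_trans ?_ h₃)
    exact WithBot.coe_le_coe.2 (h₁.trans h₂)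
end

section
/- Assume r ≥ 2 and set δ_r = μ_r − μ_{r−1}. For every n ≥ δ_r, the following identity of formal power series in ℤ[[t]] holds: (1−t)^{δ_r} · H_{A_n}(t) = (1−t)^{δ_r} · (1 + t + ⋯ + t^{a_r−1}) · H_{A_{n−1}}(t) + t^{a_r} · H_{B_{n−δ_r}}(t). (Equivalently, H_{A_n}(t) = (1+t+⋯+t^{a_r−1}) H_{A_{n−1}}(t) + t^{a_r}/(1−t)^{δ_r} · H_{B_{n−δ_r}}(t).) -/
open MvPolynomial

/-- The exponent vector `e` is divisible by some monomial in the `Inc`-orbit of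
`∏ j < r, x_{μ j} ^ a j`. -/
def OrbitDvd (r : ℕ) (μ a : ℕ → ℕ) (e : ℕ →₀ ℕ) : Prop :=
  ∃ π : ℕ → ℕ, StrictMono π ∧ ∀ j < r, a j ≤ e (π (μ j))

/-- The exponent vector `e` is divisible by some monomial in the `Inc`-orbit of
`∏ j ≤ s, x_{μ j} ^ a j` whose last variable has index at most `m`. -/
def OrbitDvdBelow (s : ℕ) (μ a : ℕ → ℕ) (m : ℕ) (e : ℕ →₀ ℕ) : Prop :=
  ∃ π : ℕ → ℕ, StrictMono π ∧ π (μ s) ≤ m ∧ ∀ j < s + 1, a j ≤ e (π (μ j))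

open Classical in
/-- The generating series, by total degree, of the exponent vectors supported on `s` that
satisfy `P`. -/
noncomputable def countSeries (s : Finset ℕ) (P : (ℕ →₀ ℕ) → Prop) : PowerSeries ℤ :=
  PowerSeries.mk fun j => (((s.finsuppAntidiag j).filter P).card : ℤ)

theorem countSeries_congr {s : Finset ℕ} {P Q : (ℕ →₀ ℕ) → Prop}
    (h : ∀ e : ℕ →₀ ℕ, e.support ⊆ s → (P e ↔ Q e)) : countSeries s P = countSeries s Q := by
  classical
  ext j
  simp only [countSeries, PowerSeries.coeff_mk]
  congr 2
  refine Finset.filter_congr fun e he => h e (Finset.mem_finsuppAntidiag.1 he).2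

theorem card_filter_finsuppAntidiag_insert {s : Finset ℕ} {m : ℕ} (hm : m ∉ s) (j : ℕ)
    (P : (ℕ →₀ ℕ) → Prop) [DecidablePred P] :
    (((insert m s).finsuppAntidiag j).filter P).card =
      ∑ p ∈ Finset.HasAntidiagonal.antidiagonal j,
        ((s.finsuppAntidiag p.2).filter fun e => P (e.update m p.1)).card := by
  classical
  rw [← Finset.card_sigma]
  symm
  refine Finset.card_bij (fun x _ => x.2.update m x.1.1) ?_ ?_ ?_
  · rintro ⟨p, e⟩ h
    simp only [Finset.mem_sigma, Finset.mem_filter] at h ⊢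
    exact ⟨(Finset.mem_finsuppAntidiag_insert hm _).2 ⟨p, h.1, e, rfl, h.2.1⟩, h.2.2⟩
  · rintro ⟨⟨k, l⟩, e⟩ h ⟨⟨k', l'⟩, e'⟩ h' heq
    simp only [Finset.mem_sigma, Finset.mem_filter, Finset.HasAntidiagonal.mem_antidiagonal] at h h'
    have hk : k = k' := by simpa using DFunLike.congr_fun heq m
    have hl : l = l' := by omega
    have he : e = e' := by
      ext x
      by_cases hx : x = m
      · subst hx
        rw [Finsupp.notMem_support_iff.1 fun hc => hm ((Finset.mem_finsuppAntidiag.1 h.2.1).2 hc),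
          Finsupp.notMem_support_iff.1 fun hc => hm ((Finset.mem_finsuppAntidiag.1 h'.2.1).2 hc)]
      · simpa [Function.update, hx] using DFunLike.congr_fun heq x
    rw [hk, hl, he]
  · intro e he
    rw [Finset.mem_filter, Finset.mem_finsuppAntidiag_insert hm] at he
    obtain ⟨⟨p, hp, g, rfl, hg⟩, hP⟩ := he
    exact ⟨⟨p, g⟩, by simp only [Finset.mem_sigma, Finset.mem_filter]; exact ⟨hp, hg, hP⟩, rfl⟩

theorem one_sub_X_mul_countSeries_insert {s : Finset ℕ} {m : ℕ} (hm : m ∉ s) (a : ℕ)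
    (P Q R : (ℕ →₀ ℕ) → Prop)
    (hQ : ∀ e : ℕ →₀ ℕ, e.support ⊆ s → ∀ k < a, (P (e.update m k) ↔ Q e))
    (hR : ∀ e : ℕ →₀ ℕ, e.support ⊆ s → ∀ k, a ≤ k → (P (e.update m k) ↔ R e)) :
    (1 - PowerSeries.X) * countSeries (insert m s) P =
      (1 - PowerSeries.X) * (∑ k ∈ Finset.range a, PowerSeries.X ^ k) * countSeries s Q +
        PowerSeries.X ^ a * countSeries s R := by
  classical
  have key : countSeries (insert m s) P =
      (∑ k ∈ Finset.range a, PowerSeries.X ^ k) * countSeries s Q +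
        (PowerSeries.X ^ a * PowerSeries.mk 1) * countSeries s R := by
    ext j
    rw [map_add, PowerSeries.coeff_mul, PowerSeries.coeff_mul, ← Finset.sum_add_distrib]
    simp only [countSeries, PowerSeries.coeff_mk]
    rw [card_filter_finsuppAntidiag_insert hm, Nat.cast_sum]
    refine Finset.sum_congr rfl fun p _ => ?_
    simp only [map_sum, PowerSeries.coeff_X_pow, PowerSeries.coeff_X_pow_mul', Finset.sum_ite_eq,
      Finset.mem_range, PowerSeries.coeff_mk, Pi.one_apply]
    rcases lt_or_ge p.1 a with hp | hp
    · rw [if_pos hp, if_neg (not_le.2 hp), one_mul, zero_mul, add_zero]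
      congr 2
      exact Finset.filter_congr fun e he => hQ e (Finset.mem_finsuppAntidiag.1 he).2 _ hp
    · rw [if_neg (not_lt.2 hp), if_pos hp, one_mul, zero_mul, zero_add]
      congr 2
      exact Finset.filter_congr fun e he => hR e (Finset.mem_finsuppAntidiag.1 he).2 _ hp
  rw [key]
  linear_combination (PowerSeries.X ^ a * countSeries s R) *
    PowerSeries.mk_one_mul_one_sub_eq_one ℤ

theorem one_sub_X_pow_mul_countSeries (m d : ℕ) (R : (ℕ →₀ ℕ) → Prop)
    (hR : ∀ (e : ℕ →₀ ℕ) (k j : ℕ), m < j → (R (e.update j k) ↔ R e)) :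
    (1 - PowerSeries.X) ^ d * countSeries (Finset.Icc 1 (m + d)) R =
      countSeries (Finset.Icc 1 m) R := by
  induction d with
  | zero => simp
  | succ d ih =>
    have h := one_sub_X_mul_countSeries_insert (s := Finset.Icc 1 (m + d)) (m := m + d + 1)
      (by simp) 0 R R R (fun _ _ _ hk => absurd hk (by simp))
      (fun e _ k _ => hR e k _ (by omega))
    have hIcc : insert (m + d + 1) (Finset.Icc 1 (m + d)) = Finset.Icc 1 (m + (d + 1)) := by
      ext; simp; omega
    rw [hIcc] at h
    rw [pow_succ, mul_assoc, h, ← ih]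
    simp

section Orbit

variable {s : ℕ} {μ a : ℕ → ℕ}

theorem orbitDvd_update_of_lt (hμ : StrictMonoOn μ (Set.Iio (s + 2)))
    (ha : ∀ j < s + 2, 0 < a j) {e : ℕ →₀ ℕ} {n k : ℕ} (he : e.support ⊆ Finset.Icc 1 n)
    (hk : k < a (s + 1)) :
    OrbitDvd (s + 2) μ a (e.update (n + 1) k) ↔ OrbitDvd (s + 2) μ a e := by
  have hzero : ∀ i, n < i → e i = 0 := fun i hi =>
    Finsupp.notMem_support_iff.1 fun hc => by have := Finset.mem_Icc.1 (he hc); omega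
  refine exists_congr fun π => and_congr_right fun hπ => ?_
  constructor
  · intro h j hj
    have hne : π (μ j) ≠ n + 1 := by
      intro hc
      rcases (show j < s + 1 ∨ j = s + 1 by omega) with hj' | rfl
      · have h1 := hπ (hμ (Set.mem_Iio.2 hj) (Set.mem_Iio.2 (Nat.lt_succ_self (s + 1))) hj')
        have h2 := h (s + 1) (by omega)
        have h3 := ha (s + 1) (by omega)
        rw [Finsupp.update_apply, if_neg (by omega), hzero _ (by omega)] at h2
        omega
      · have h2 := h (s + 1) hj
        rw [Finsupp.update_apply, if_pos hc] at h2
        omega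
    have := h j hj
    rwa [Finsupp.update_apply, if_neg hne] at this
  · intro h j hj
    have hne : π (μ j) ≠ n + 1 := by
      intro hc
      have h2 := h j hj
      have h3 := ha j hj
      rw [hzero _ (by omega)] at h2
      omega
    rw [Finsupp.update_apply, if_neg hne]
    exact h j hj

theorem orbitDvd_update_of_le (hμ : StrictMonoOn μ (Set.Iio (s + 2)))
    (ha : ∀ j < s + 2, 0 < a j) {e : ℕ →₀ ℕ} {m d k : ℕ} (hd : μ (s + 1) = μ s + (d + 1))
    (he : e.support ⊆ Finset.Icc 1 (m + d)) (hk : a (s + 1) ≤ k) :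
    OrbitDvd (s + 2) μ a (e.update (m + d + 1) k) ↔ OrbitDvdBelow s μ a m e := by
  have hzero : ∀ i, m + d < i → e i = 0 := fun i hi =>
    Finsupp.notMem_support_iff.1 fun hc => by have := Finset.mem_Icc.1 (he hc); omega
  constructor
  · rintro ⟨π, hπ, h⟩
    have hlast : π (μ (s + 1)) ≤ m + d + 1 := by
      by_contra! hc
      have h2 := h (s + 1) (by omega)
      have h3 := ha (s + 1) (by omega)
      rw [Finsupp.update_apply, if_neg (by omega), hzero _ (by omega)] at h2
      omega
    refine ⟨π, hπ, ?_, fun j hj => ?_⟩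
    · have := hπ.add_le_nat (d + 1) (μ s)
      rw [add_comm (d + 1) (μ s), ← hd] at this
      omega
    · have h1 := hπ (hμ (Set.mem_Iio.2 (by omega)) (Set.mem_Iio.2 (Nat.lt_succ_self (s + 1))) hj)
      have h2 := h j (by omega)
      rwa [Finsupp.update_apply, if_neg (by omega)] at h2
  · rintro ⟨π, hπ, hle, h⟩
    refine ⟨fun x => if x ≤ μ s then π x else m + (x - μ s), fun x y hxy => ?_, fun j hj => ?_⟩
    · dsimp only
      split_ifs with hx hy hy
      · exact hπ hxy
      · have := hπ.monotone hx
        omega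
      · omega
      · omega
    · dsimp only
      rcases (show j < s + 1 ∨ j = s + 1 by omega) with hj' | rfl
      · have h1 : μ j ≤ μ s := hμ.monotoneOn (Set.mem_Iio.2 hj) (Set.mem_Iio.2 (by omega))
          (by omega)
        have h2 := hπ.monotone h1
        rw [if_pos h1, Finsupp.update_apply, if_neg (by omega)]
        exact h j hj'
      · rw [if_neg (by omega), Finsupp.update_apply, if_pos (by omega)]
        exact hk

theorem orbitDvdBelow_update (hμ : StrictMonoOn μ (Set.Iio (s + 2))) {e : ℕ →₀ ℕ} {m j k : ℕ}
    (hj : m < j) : OrbitDvdBelow s μ a m (e.update j k) ↔ OrbitDvdBelow s μ a m e := by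
  refine exists_congr fun π => and_congr_right fun hπ => and_congr_right fun hle =>
    forall₂_congr fun i hi => ?_
  have h := hπ.monotone (hμ.monotoneOn (Set.mem_Iio.2 (show i < s + 2 by omega))
    (Set.mem_Iio.2 (show s < s + 2 by omega)) (show i ≤ s by omega))
  rw [Finsupp.update_apply, if_neg (by omega)]

theorem orbitDvdBelow_iff (ha : ∀ j < s + 2, 0 < a j) {e : ℕ →₀ ℕ} {m : ℕ}
    (he : e.support ⊆ Finset.Icc 1 m) :
    OrbitDvdBelow s μ a m e ↔ OrbitDvd (s + 1) μ a e := by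
  refine exists_congr fun π => and_congr_right fun _ => and_iff_right_of_imp fun h => ?_
  have h1 := h s (by omega)
  have h2 := ha s (by omega)
  exact (Finset.mem_Icc.1 (he (Finsupp.mem_support_iff.2 (by omega)))).2

end Orbit

theorem sum_single_le_iff {r : ℕ} {ν a : ℕ → ℕ} (hν : Set.InjOn ν (Set.Iio r)) (e : ℕ →₀ ℕ) :
    ∑ j ∈ Finset.range r, Finsupp.single (ν j) (a j) ≤ e ↔ ∀ j < r, a j ≤ e (ν j) := by
  classical
  have hval : ∀ j < r, (∑ i ∈ Finset.range r, Finsupp.single (ν i) (a i)) (ν j) = a j := by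
    intro j hj
    rw [Finsupp.finsetSum_apply, Finset.sum_eq_single j]
    · simp
    · intro i hi hij
      refine Finsupp.single_eq_of_ne fun hc => hij (hν (Finset.mem_range.1 hi) hj hc.symm)
    · intro h
      exact absurd (Finset.mem_range.2 hj) h
  constructor
  · intro h j hj
    exact (hval j hj).symm.le.trans (h (ν j))
  · intro h x
    by_cases hx : ∃ j < r, ν j = x
    · obtain ⟨j, hj, rfl⟩ := hx
      rw [hval j hj]
      exact h j hj
    · push Not at hx
      rw [Finsupp.finsetSum_apply, Finset.sum_eq_zero]
      · exact Nat.zero_le _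
      · intro i hi
        exact Finsupp.single_eq_of_ne (hx i (Finset.mem_range.1 hi)).symm

section Hilbert

variable (K : Type*) [Field K]

theorem rename_orbMon_s3 (r : ℕ) (μ a π : ℕ → ℕ) :
    rename π (orbMon K r μ a) =
      monomial (∑ j ∈ Finset.range r, Finsupp.single (π (μ j)) (a j)) 1 := by
  simp [orbMon, monomial_sum_one, X_pow_eq_monomial, rename_monomial, Finsupp.mapDomain_single]

theorem mem_orbitIdeal_orbMon (r : ℕ) (μ a : ℕ → ℕ) (hμ : Set.InjOn μ (Set.Iio r))
    (p : MvPolynomial ℕ K) :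
    p ∈ orbitIdeal K (orbMon K r μ a) ↔ ∀ e ∈ p.support, OrbitDvd r μ a e := by
  have hset : {q | ∃ π : ℕ → ℕ, StrictMono π ∧ q = rename π (orbMon K r μ a)} =
      (fun e => monomial e (1 : K)) '' {e | ∃ π : ℕ → ℕ, StrictMono π ∧
        e = ∑ j ∈ Finset.range r, Finsupp.single (π (μ j)) (a j)} := by
    ext q
    constructor
    · rintro ⟨π, hπ, rfl⟩
      exact ⟨_, ⟨π, hπ, rfl⟩, (rename_orbMon_s3 K r μ a π).symm⟩
    · rintro ⟨_, ⟨π, hπ, rfl⟩, rfl⟩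
      exact ⟨π, hπ, (rename_orbMon_s3 K r μ a π).symm⟩
  rw [orbitIdeal, hset, mem_ideal_span_monomial_image]
  refine forall₂_congr fun e _ => ?_
  constructor
  · rintro ⟨_, ⟨π, hπ, rfl⟩, h⟩
    exact ⟨π, hπ, (sum_single_le_iff (hπ.injective.comp_injOn hμ) e).1 h⟩
  · rintro ⟨π, hπ, h⟩
    exact ⟨_, ⟨π, hπ, rfl⟩, (sum_single_le_iff (hπ.injective.comp_injOn hμ) e).2 h⟩

theorem mem_finsuppAntidiag_of_mem_support_toBig {n j : ℕ} {p : MvPolynomial (VarIdx n) K}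
    (hp : p.IsHomogeneous j) {e : ℕ →₀ ℕ} (he : e ∈ (toBig K n p).support) :
    e ∈ (Finset.Icc 1 n).finsuppAntidiag j := by
  classical
  have hsupp : e.support ⊆ Finset.Icc 1 n := fun i hi => by
    have := vars_rename _ _ (support_subset_vars_of_mem_support he hi)
    obtain ⟨x, -, rfl⟩ := Finset.mem_image.1 this
    exact x.2
  refine Finset.mem_finsuppAntidiag'.2 ⟨?_, hsupp⟩
  have h := (IsHomogeneous.rename_isHomogeneous (f := Subtype.val) hp) (mem_support_iff.1 he)
  simpa [Finsupp.weight_apply] using h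

theorem exists_isHomogeneous_toBig_eq {n j : ℕ} {q : MvPolynomial ℕ K}
    (hq : ∀ e ∈ q.support, e ∈ (Finset.Icc 1 n).finsuppAntidiag j) :
    ∃ p : MvPolynomial (VarIdx n) K, p.IsHomogeneous j ∧ toBig K n p = q := by
  obtain ⟨p, hp⟩ := exists_rename_eq_of_vars_subset_range q
    (Subtype.val : VarIdx n → ℕ) Subtype.val_injective (by
      intro i hi
      obtain ⟨e, he, hie⟩ := (mem_vars_iff_mem_support i).1 hi
      exact ⟨⟨i, (Finset.mem_finsuppAntidiag.1 (hq e he)).2 hie⟩, rfl⟩)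
  refine ⟨p, (IsHomogeneous.rename_isHomogeneous_iff Subtype.val_injective).1 ?_, hp⟩
  rw [hp]
  intro e he
  simpa [Finsupp.weight_apply] using (Finset.mem_finsuppAntidiag'.1 (hq e (mem_support_iff.2 he))).1

open Classical in
theorem hilbF_restr {I : Ideal (MvPolynomial ℕ K)} {P : (ℕ →₀ ℕ) → Prop}
    (hI : ∀ p, p ∈ I ↔ ∀ e ∈ p.support, P e) (n j : ℕ) :
    hilbF K (restr K I n) j =
      (((Finset.Icc 1 n).finsuppAntidiag j).filter fun e => ¬ P e).card := by
  set T := ((Finset.Icc 1 n).finsuppAntidiag j).filter fun e => ¬ P e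
  let φ : homogeneousSubmodule (VarIdx n) K j →ₗ[K] (T → K) :=
    LinearMap.pi fun e => (lcoeff K e.1) ∘ₗ (toBig K n).toLinearMap ∘ₗ Submodule.subtype _
  have hφ : ∀ p e, φ p e = coeff e.1 (toBig K n p.1) := fun _ _ => rfl
  have hker : LinearMap.ker φ =
      Submodule.comap (homogeneousSubmodule (VarIdx n) K j).subtype
        (Submodule.restrictScalars K (restr K I n)) := by
    ext p
    have hmem : p ∈ Submodule.comap (homogeneousSubmodule (VarIdx n) K j).subtype
        (Submodule.restrictScalars K (restr K I n)) ↔ toBig K n p.1 ∈ I := Iff.rfl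
    rw [hmem, hI, LinearMap.mem_ker]
    constructor
    · intro h e he
      by_contra hP
      have hT : e ∈ T :=
        Finset.mem_filter.2 ⟨mem_finsuppAntidiag_of_mem_support_toBig K p.2 he, hP⟩
      exact mem_support_iff.1 he (congrFun h ⟨e, hT⟩)
    · intro h
      funext e
      rw [hφ]
      by_contra hne
      exact (Finset.mem_filter.1 e.2).2 (h e.1 (mem_support_iff.2 hne))
  have hsurj : Function.Surjective φ := by
    intro f
    have hcoeff : ∀ e, coeff e (∑ t : T, monomial t.1 (f t)) =
        if h : e ∈ T then f ⟨e, h⟩ else 0 := by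
      intro e
      rw [coeff_sum]
      simp only [coeff_monomial]
      split_ifs with h
      · rw [Finset.sum_eq_single ⟨e, h⟩]
        · simp
        · intro t _ ht
          exact if_neg fun hc => ht (Subtype.ext hc)
        · simp
      · exact Finset.sum_eq_zero fun t _ => if_neg fun (hc : t.1 = e) => h (hc ▸ t.2)
    obtain ⟨p, hp, hpq⟩ := exists_isHomogeneous_toBig_eq K (n := n) (j := j)
      (q := ∑ t : T, monomial t.1 (f t)) (by
        intro e he
        rw [mem_support_iff, hcoeff] at he
        by_cases h : e ∈ T
        · exact (Finset.mem_filter.1 h).1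
        · exact absurd (dif_neg h) he)
    refine ⟨⟨p, hp⟩, funext fun e => ?_⟩
    rw [hφ, hpq, hcoeff, dif_pos e.2]
  rw [hilbF, ← hker, (φ.quotKerEquivOfSurjective hsurj).finrank_eq,
    Module.finrank_fintype_fun_eq_card, Fintype.card_coe]

theorem hseries_restr_orbitIdeal (r : ℕ) (μ a : ℕ → ℕ) (hμ : Set.InjOn μ (Set.Iio r)) (n : ℕ) :
    hseries K (restr K (orbitIdeal K (orbMon K r μ a)) n) =
      countSeries (Finset.Icc 1 n) fun e => ¬ OrbitDvd r μ a e := by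
  ext j
  rw [hseries, countSeries, PowerSeries.coeff_mk, PowerSeries.coeff_mk,
    hilbF_restr K (mem_orbitIdeal_orbMon K r μ a hμ)]
  congr!

end Hilbert

/-- For `r ≥ 2`, `δ_r = μ_r - μ_{r-1}` and `n ≥ δ_r`:
`(1-t)^{δ_r}·H_{A_n}(t) = (1-t)^{δ_r}·(1+t+⋯+t^{a_r-1})·H_{A_{n-1}}(t) + t^{a_r}·H_{B_{n-δ_r}}(t)`. -/
theorem statement3 (K : Type*) [Field K] (r : ℕ) (hr : 2 ≤ r) (μ a : ℕ → ℕ)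
    (hμ1 : 1 ≤ μ 0) (hμ : ∀ j, j + 1 < r → μ j < μ (j + 1))
    (ha : ∀ j, j < r → 0 < a j) (n : ℕ) (hn : μ (r - 1) - μ (r - 2) ≤ n) :
    (1 - PowerSeries.X : PowerSeries ℤ) ^ (μ (r - 1) - μ (r - 2)) *
        hseries K (restr K (orbitIdeal K (orbMon K r μ a)) n) =
      (1 - PowerSeries.X : PowerSeries ℤ) ^ (μ (r - 1) - μ (r - 2)) *
          (∑ k ∈ Finset.range (a (r - 1)), (PowerSeries.X : PowerSeries ℤ) ^ k) *
          hseries K (restr K (orbitIdeal K (orbMon K r μ a)) (n - 1)) +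
        (PowerSeries.X : PowerSeries ℤ) ^ a (r - 1) *
          hseries K (restr K (orbitIdeal K (orbMon K (r - 1) μ a))
            (n - (μ (r - 1) - μ (r - 2)))) := by
  obtain ⟨s, rfl⟩ : ∃ s, r = s + 2 := ⟨r - 2, by omega⟩
  change μ (s + 1) - μ s ≤ n at hn
  change (1 - PowerSeries.X : PowerSeries ℤ) ^ (μ (s + 1) - μ s) *
        hseries K (restr K (orbitIdeal K (orbMon K (s + 2) μ a)) n) =
      (1 - PowerSeries.X : PowerSeries ℤ) ^ (μ (s + 1) - μ s) *
          (∑ k ∈ Finset.range (a (s + 1)), (PowerSeries.X : PowerSeries ℤ) ^ k) *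
          hseries K (restr K (orbitIdeal K (orbMon K (s + 2) μ a)) (n - 1)) +
        (PowerSeries.X : PowerSeries ℤ) ^ a (s + 1) *
          hseries K (restr K (orbitIdeal K (orbMon K (s + 1) μ a)) (n - (μ (s + 1) - μ s)))
  have hmono : StrictMonoOn μ (Set.Iio (s + 2)) :=
    strictMonoOn_of_lt_succ Set.ordConnected_Iio fun j _ _ hj => hμ j hj
  have hinj : Set.InjOn μ (Set.Iio (s + 2)) := hmono.injOn
  rw [hseries_restr_orbitIdeal K (s + 2) μ a hinj, hseries_restr_orbitIdeal K (s + 2) μ a hinj,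
    hseries_restr_orbitIdeal K (s + 1) μ a (hinj.mono (Set.Iio_subset_Iio (by omega)))]
  have hlt : μ s < μ (s + 1) := hμ s (by omega)
  obtain ⟨d, hd⟩ : ∃ d, μ (s + 1) = μ s + (d + 1) := ⟨μ (s + 1) - μ s - 1, by omega⟩
  have hδ : μ (s + 1) - μ s = d + 1 := by omega
  rw [hδ] at hn ⊢
  obtain ⟨m, rfl⟩ : ∃ m, n = m + (d + 1) := ⟨n - (d + 1), by omega⟩
  have hrec := one_sub_X_mul_countSeries_insert (s := Finset.Icc 1 (m + d)) (m := m + d + 1)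
    (by simp) (a (s + 1)) (fun e => ¬ OrbitDvd (s + 2) μ a e)
    (fun e => ¬ OrbitDvd (s + 2) μ a e) (fun e => ¬ OrbitDvdBelow s μ a m e)
    (fun e he k hk => by rw [orbitDvd_update_of_lt hmono ha he hk])
    (fun e he k hk => by rw [orbitDvd_update_of_le hmono ha hd he hk])
  have hcut := one_sub_X_pow_mul_countSeries m d (fun e => ¬ OrbitDvdBelow s μ a m e)
    (fun e k j hj => by rw [orbitDvdBelow_update hmono hj])
  have hcongr : countSeries (Finset.Icc 1 m) (fun e => ¬ OrbitDvdBelow s μ a m e) =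
      countSeries (Finset.Icc 1 m) (fun e => ¬ OrbitDvd (s + 1) μ a e) :=
    countSeries_congr fun e he => by rw [orbitDvdBelow_iff ha he]
  rw [hcongr] at hcut
  have hIcc : insert (m + d + 1) (Finset.Icc 1 (m + d)) = Finset.Icc 1 (m + (d + 1)) := by
    ext; simp; omega
  rw [hIcc] at hrec
  rw [show m + (d + 1) - 1 = m + d by omega, show m + (d + 1) - (d + 1) = m by omega, ← hcut,
    pow_succ, mul_assoc, hrec]
  ring
end

section
/- In the polynomial ring ℤ[s,t], the polynomial g̃(s,t) = (1−t)^{μ_r−r} · ∏_{i=1}^{r} (1 − t − s + s·t^{a_i}) − s^{μ_r} · t^{a_1 + ⋯ + a_r} is divisible by (1 − t − s), but for each i ∈ {1, …, r} it is not divisible by the polynomial 1 − s·(1 + t + ⋯ + t^{a_i−1}). -/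
/-- A strictly increasing sequence of naturals starting at a positive value satisfies
`j + 1 ≤ μ j`. -/
theorem succ_le_of_strictly_increasing (r : ℕ) (μ : ℕ → ℕ) (hμ1 : 1 ≤ μ 0)
    (hμ : ∀ j, j + 1 < r → μ j < μ (j + 1)) (j : ℕ) (hj : j < r) : j + 1 ≤ μ j := by
  induction j with
  | zero => exact hμ1
  | succ k ih =>
    have := ih (by omega)
    have := hμ k hj
    omega

/-- In `ℤ[s,t]` (realized as `(ℤ[t])[s]`, with `s` the outer and `t` the
inner variable), the polynomial
`g̃(s,t) = (1-t)^{μ_r-r}·∏ᵢ(1-t-s+s·t^{aᵢ}) - s^{μ_r}·t^{a₁+⋯+a_r}`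
is divisible by `1-t-s` but, for each `i < r`, not by `1-s·(1+t+⋯+t^{aᵢ-1})`. -/
theorem statement7 (r : ℕ) (hr : 1 ≤ r) (μ a : ℕ → ℕ)
    (hμ1 : 1 ≤ μ 0) (hμ : ∀ j, j + 1 < r → μ j < μ (j + 1))
    (ha : ∀ j, j < r → 0 < a j) :
    letI s : Polynomial (Polynomial ℤ) := Polynomial.X
    letI t : Polynomial (Polynomial ℤ) := Polynomial.C Polynomial.X
    letI g : Polynomial (Polynomial ℤ) :=
      (1 - t) ^ (μ (r - 1) - r) * ∏ i ∈ Finset.range r, (1 - t - s + s * t ^ a i) -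
        s ^ μ (r - 1) * t ^ (∑ i ∈ Finset.range r, a i)
    (1 - t - s) ∣ g ∧
      ∀ i, i < r → ¬ ((1 - s * ∑ k ∈ Finset.range (a i), t ^ k) ∣ g) := by
  set s : Polynomial (Polynomial ℤ) := Polynomial.X
  set t : Polynomial (Polynomial ℤ) := Polynomial.C Polynomial.X
  constructor
  · have hle : r ≤ μ (r - 1) := by
      have := succ_le_of_strictly_increasing r μ hμ1 hμ (r - 1) (by omega)
      omega
    rw [← Ideal.mem_span_singleton, ← Ideal.Quotient.eq_zero_iff_mem]
    set q := Ideal.Quotient.mk (Ideal.span {1 - t - s})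
    have hst : 1 - q t - q s = 0 := by
      rw [← map_one q, ← map_sub, ← map_sub]
      exact Ideal.Quotient.eq_zero_iff_mem.2 (Ideal.mem_span_singleton_self _)
    have ht : 1 - q t = q s := sub_eq_zero.mp hst
    simp only [map_sub, map_mul, map_pow, map_prod, map_add, map_one, ht, sub_self, zero_add,
      Finset.prod_mul_distrib, Finset.prod_const, Finset.card_range, Finset.prod_pow_eq_pow_sum]
    rw [← mul_assoc, ← pow_add, Nat.sub_add_cancel hle, sub_self]
  · rintro i hi ⟨c, hc⟩
    have hai : (a i : ℚ) ≠ 0 := by exact_mod_cast (ha i hi).ne'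
    let φ : Polynomial (Polynomial ℤ) →+* ℚ :=
      Polynomial.eval₂RingHom (Polynomial.eval₂RingHom (Int.castRingHom ℚ) 1) (a i : ℚ)⁻¹
    have hs : φ s = (a i : ℚ)⁻¹ := by simp [φ, s]
    have ht : φ t = 1 := by simp [φ, t]
    have hprod : ∏ _j ∈ Finset.range r, (-(a i : ℚ)⁻¹ + (a i : ℚ)⁻¹) = 0 :=
      Finset.prod_eq_zero (Finset.mem_range.2 hi) (by ring)
    have h := congrArg φ hc
    simp only [map_sub, map_mul, map_pow, map_prod, map_sum, map_add, map_one, hs, ht, one_pow,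
      mul_one, Finset.sum_const, Finset.card_range, nsmul_eq_mul, hprod, inv_mul_cancel₀ hai,
      sub_self, mul_zero, zero_mul, zero_sub, neg_eq_zero] at h
    exact pow_ne_zero _ (inv_ne_zero hai) h
end
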